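/- arXiv:1908.04191 — 2 statements merged into one kernel-verified Lean document; each statement's English description precedes it below -/
import Mathlib

section
/- Let m ≥ 1 and let r ∈ {0, 1, …, m−1}. Then for every positive definite symmetric m×m real matrix Q, (det Q)^{−r/2} = π^{−mr/2} ∫_{ℝ^{m×r}} exp(−tr(Q Z Zᵀ)) dZ, where the integral is over all real m×r matrices Z with respect to Lebesgue measure. Consequently, the function Q ↦ det(Q)^{−r/2} is completely monotone on the cone of positive definite symmetric m×m matrices, with Riesz measure the pushforward of the measure π^{−mr/2} dZ on ℝ^{m×r} under the map Z ↦ Z Zᵀ. -/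
open MeasureTheory Real Set

noncomputable def iterDirDeriv {E : Type*} [NormedAddCommGroup E] [NormedSpace ℝ E] :
    ℕ → (ℕ → E) → (E → ℝ) → E → ℝ
  | 0, _, f => f
  | (k+1), v, f => fun x => fderiv ℝ (iterDirDeriv k (fun i => v (i+1)) f) x (v 0)

/-- A function is completely monotone on `C` if it is smooth on `C` and its iterated
directional derivatives along vectors of `C` satisfy the alternating sign condition. -/
def CompletelyMonotoneOn {E : Type*} [NormedAddCommGroup E] [NormedSpace ℝ E]
    (f : E → ℝ) (C : Set E) : Prop :=
  ContDiffOn ℝ (⊤ : ℕ∞) f C ∧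
  ∀ (k : ℕ) (v : ℕ → E), (∀ i, v i ∈ C) → ∀ x ∈ C, 0 ≤ (-1 : ℝ) ^ k * iterDirDeriv k v f x

/-- The iterated difference `(1 - T_w₁) ⋯ (1 - T_wₙ) g`, where `T_w g x = g (x + w)`. -/
def altDiff {E : Type*} [Add E] : List E → (E → ℝ) → E → ℝ
  | [], g => g
  | w :: l, g => altDiff l (fun x => g x - g (x + w))

lemma altDiff_div {E : Type*} [Add E] (l : List E) (g : E → ℝ) (c : ℝ) (x : E) :
    altDiff l (fun y => g y / c) x = altDiff l g x / c := by
  induction l generalizing g with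
  | nil => rfl
  | cons w l ih => simp only [altDiff, ← sub_div, ih]

lemma tendsto_altDiff {E ι : Type*} [Add E] {C : Set E} (hadd : ∀ x ∈ C, ∀ y ∈ C, x + y ∈ C)
    {F : Filter ι} (l : List E) (hl : ∀ w ∈ l, w ∈ C) {g : ι → E → ℝ} {g' : E → ℝ}
    (h : ∀ x ∈ C, Filter.Tendsto (fun i => g i x) F (nhds (g' x))) :
    ∀ x ∈ C, Filter.Tendsto (fun i => altDiff l (g i) x) F (nhds (altDiff l g' x)) := by
  induction l generalizing g g' with
  | nil => exact h
  | cons w l ih =>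
    refine ih (fun v hv => hl v (List.mem_cons_of_mem _ hv)) fun x hx => ?_
    exact (h x hx).sub (h _ (hadd x hx w (hl w List.mem_cons_self)))

lemma altDiff_congr {E : Type*} [Add E] {C : Set E} (hadd : ∀ x ∈ C, ∀ y ∈ C, x + y ∈ C)
    (l : List E) (hl : ∀ w ∈ l, w ∈ C) {g g' : E → ℝ} (h : ∀ x ∈ C, g x = g' x) :
    ∀ x ∈ C, altDiff l g x = altDiff l g' x := by
  induction l generalizing g g' with
  | nil => exact h
  | cons w l ih =>
    refine ih (fun v hv => hl v (List.mem_cons_of_mem _ hv)) fun x hx => ?_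
    rw [h x hx, h _ (hadd x hx w (hl w List.mem_cons_self))]

lemma altDiff_integral_exp_nonneg {E α : Type*} [Add E] [MeasurableSpace α] {μ : Measure α}
    {C : Set E} (hadd : ∀ x ∈ C, ∀ y ∈ C, x + y ∈ C) {p : E → α → ℝ}
    (hp : ∀ x y z, p (x + y) z = p x z + p y z) (hp0 : ∀ x ∈ C, ∀ z, 0 ≤ p x z)
    (l : List E) (hl : ∀ w ∈ l, w ∈ C) {φ : α → ℝ} (hφ : ∀ z, 0 ≤ φ z)
    (hint : ∀ x ∈ C, Integrable (fun z => exp (-p x z) * φ z) μ) {g : E → ℝ}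
    (hg : ∀ x ∈ C, g x = ∫ z, exp (-p x z) * φ z ∂μ) :
    ∀ x ∈ C, 0 ≤ altDiff l g x := by
  induction l generalizing φ g with
  | nil =>
    intro x hx
    rw [altDiff, hg x hx]
    exact integral_nonneg fun z => mul_nonneg (exp_pos _).le (hφ z)
  | cons w l ih =>
    have hw : w ∈ C := hl w List.mem_cons_self
    have key : ∀ x z, exp (-p x z) * ((1 - exp (-p w z)) * φ z) =
        exp (-p x z) * φ z - exp (-p (x + w) z) * φ z := by
      intro x z
      rw [hp, neg_add, exp_add]
      ring
    refine ih (φ := fun z => (1 - exp (-p w z)) * φ z)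
      (fun v hv => hl v (List.mem_cons_of_mem _ hv)) (fun z => ?_) (fun x hx => ?_)
      (fun x hx => ?_)
    · refine mul_nonneg (sub_nonneg.2 (exp_le_one_iff.2 ?_)) (hφ z)
      exact neg_nonpos.2 (hp0 w hw z)
    · simp only [key]
      exact (hint x hx).sub (hint _ (hadd x hx w hw))
    · simp only [key]
      rw [integral_sub (hint x hx) (hint _ (hadd x hx w hw)), hg x hx, hg _ (hadd x hx w hw)]

section CompletelyMonotone

variable {E : Type*} [NormedAddCommGroup E] [NormedSpace ℝ E]

lemma ContDiffOn.iterDirDeriv {f : E → ℝ} {U : Set E} (hU : IsOpen U)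
    (hf : ContDiffOn ℝ (⊤ : ℕ∞) f U) (k : ℕ) (v : ℕ → E) :
    ContDiffOn ℝ (⊤ : ℕ∞) (iterDirDeriv k v f) U := by
  induction k generalizing v with
  | zero => exact hf
  | succ k ih =>
    exact ((ih _).fderiv_of_isOpen hU (by simp)).clm_apply contDiffOn_const

lemma altDiff_neg_fderiv_nonneg {C : Set E} (hadd : ∀ x ∈ C, ∀ y ∈ C, x + y ∈ C)
    (hsmul : ∀ c : ℝ, 0 < c → ∀ x ∈ C, c • x ∈ C) {g : E → ℝ}
    (hd : ∀ x ∈ C, DifferentiableAt ℝ g x)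
    (hg : ∀ l : List E, (∀ w ∈ l, w ∈ C) → ∀ x ∈ C, 0 ≤ altDiff l g x) {v : E} (hv : v ∈ C)
    (l : List E) (hl : ∀ w ∈ l, w ∈ C) :
    ∀ x ∈ C, 0 ≤ altDiff l (fun y => -(fderiv ℝ g y v)) x := by
  intro x hx
  have hlim : ∀ y ∈ C, Filter.Tendsto (fun t : ℝ => (g y - g (y + t • v)) / t)
      (nhdsWithin 0 (Ioi 0)) (nhds (-(fderiv ℝ g y v))) := by
    intro y hy
    have h := ((hd y hy).hasFDerivAt.hasLineDerivAt v).tendsto_slope_zero_right.neg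
    refine h.congr fun t => ?_
    simp only [smul_eq_mul]
    ring
  refine ge_of_tendsto (tendsto_altDiff hadd l hl hlim x hx) ?_
  filter_upwards [self_mem_nhdsWithin] with t ht
  rw [altDiff_div]
  refine div_nonneg (hg ((t • v) :: l) ?_ x hx) (le_of_lt ht)
  rintro w hw
  rcases List.mem_cons.1 hw with rfl | hw
  · exact hsmul t ht v hv
  · exact hl w hw

lemma completelyMonotoneOn_of_altDiff_nonneg {C U : Set E}
    (hadd : ∀ x ∈ C, ∀ y ∈ C, x + y ∈ C) (hsmul : ∀ c : ℝ, 0 < c → ∀ x ∈ C, c • x ∈ C)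
    (hU : IsOpen U) (hCU : C ⊆ U) {f : E → ℝ} (hf : ContDiffOn ℝ (⊤ : ℕ∞) f U)
    (hpos : ∀ l : List E, (∀ w ∈ l, w ∈ C) → ∀ x ∈ C, 0 ≤ altDiff l f x) :
    CompletelyMonotoneOn f C := by
  refine ⟨hf.mono hCU, fun k v hv => ?_⟩
  suffices h : ∀ l : List E, (∀ w ∈ l, w ∈ C) → ∀ x ∈ C,
      0 ≤ altDiff l (fun y => (-1 : ℝ) ^ k * iterDirDeriv k v f y) x from h [] (by simp)
  induction k generalizing v with
  | zero => simpa [iterDirDeriv] using hpos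
  | succ k ih =>
    intro l hl
    have hd : ∀ x ∈ C, DifferentiableAt ℝ (iterDirDeriv k (fun i => v (i + 1)) f) x :=
      fun x hx => ((hf.iterDirDeriv hU k _).contDiffAt (hU.mem_nhds (hCU hx))).differentiableAt
        (by simp)
    have h := altDiff_neg_fderiv_nonneg hadd hsmul (fun x hx => (hd x hx).const_mul _)
      (ih (fun i => v (i + 1)) fun i => hv _) (hv 0) l hl
    intro x hx
    rw [altDiff_congr hadd l hl (g' := fun y => -(fderiv ℝ
      (fun z => (-1 : ℝ) ^ k * iterDirDeriv k (fun i => v (i + 1)) f z) y (v 0))) ?_ x hx]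
    · exact h x hx
    · intro y hy
      rw [fderiv_const_mul (hd y hy), smul_apply, smul_eq_mul, iterDirDeriv]
      ring

end CompletelyMonotone

section Gaussian

open Matrix

lemma integral_exp_neg_sum_sq (m r : ℕ) :
    ∫ Z : Fin m → Fin r → ℝ, exp (-∑ i, ∑ j, Z i j ^ 2) = π ^ ((m : ℝ) * r / 2) := by
  have h1 : ∫ z : Fin r → ℝ, ∏ j, exp (-(z j) ^ 2) = √π ^ r := by
    rw [integral_fintype_prod_volume_eq_pow (fun t : ℝ => exp (-t ^ 2)), Fintype.card_fin]
    simpa using congrArg (· ^ r) (integral_gaussian 1)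
  have h2 := integral_fintype_prod_volume_eq_pow (ι := Fin m)
    (fun z : Fin r → ℝ => ∏ j, exp (-(z j) ^ 2))
  rw [h1, Fintype.card_fin] at h2
  simp only [← exp_sum, Finset.sum_neg_distrib] at h2
  rw [h2, ← pow_mul, sqrt_eq_rpow, ← rpow_natCast, ← rpow_mul pi_pos.le]
  congr 1
  push_cast
  ring

/-- Left multiplication by `B`, on arrays of functions. -/
def leftMul {m : ℕ} (r : ℕ) (B : Matrix (Fin m) (Fin m) ℝ) :
    (Fin m → Fin r → ℝ) →ₗ[ℝ] (Fin m → Fin r → ℝ) :=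
  mulLeftLinearMap (Fin r) ℝ B

lemma leftMul_apply {m r : ℕ} (B : Matrix (Fin m) (Fin m) ℝ) (Z : Fin m → Fin r → ℝ) :
    leftMul r B Z = B * of Z := rfl

lemma det_leftMul {m : ℕ} (r : ℕ) (B : Matrix (Fin m) (Fin m) ℝ) :
    LinearMap.det (leftMul r B) = B.det ^ r := by
  let e : (Fin m → Fin r → ℝ) ≃ₗ[ℝ] (Fin r → Fin m → ℝ) :=
    transposeLinearEquiv (Fin m) (Fin r) ℝ ℝ
  rw [← LinearMap.det_conj (leftMul r B) e]
  have h : (e : (Fin m → Fin r → ℝ) →ₗ[ℝ] (Fin r → Fin m → ℝ)) ∘ₗ leftMul r B ∘ₗ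
      (e.symm : (Fin r → Fin m → ℝ) →ₗ[ℝ] (Fin m → Fin r → ℝ)) =
      LinearMap.pi fun i => (toLin' B).comp (LinearMap.proj i) := by
    refine LinearMap.ext fun Z => ?_
    ext i j
    rfl
  rw [h, LinearMap.det_pi]
  simp

lemma Matrix.PosDef.exists_eq_transpose_mul_self {n : Type*} [Fintype n] [DecidableEq n]
    {Q : Matrix n n ℝ} (hQ : Q.PosDef) : ∃ B : Matrix n n ℝ, Q = Bᵀ * B := by
  open scoped MatrixOrder in
  obtain ⟨B, hB⟩ := CStarAlgebra.nonneg_iff_eq_star_mul_self.mp hQ.posSemidef.nonneg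
  exact ⟨B, by rw [hB, star_eq_conjTranspose, conjTranspose_eq_transpose_of_trivial]⟩

lemma trace_transpose_mul_mul {m r : ℕ} (B : Matrix (Fin m) (Fin m) ℝ) (Z : Fin m → Fin r → ℝ) :
    (Bᵀ * B * (of Z * (of Z)ᵀ)).trace = ∑ i, ∑ j, leftMul r B Z i j ^ 2 := by
  have h : (Bᵀ * B * (of Z * (of Z)ᵀ)).trace = ((B * of Z) * (B * of Z)ᵀ).trace := by
    rw [Matrix.mul_assoc, trace_mul_comm, transpose_mul]
    simp only [Matrix.mul_assoc]
  rw [h, trace]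
  refine Finset.sum_congr rfl fun i _ => ?_
  rw [diag_apply, mul_apply]
  exact Finset.sum_congr rfl fun j _ => by rw [transpose_apply, leftMul_apply, sq]

lemma integral_exp_neg_trace_mul {m : ℕ} (r : ℕ) {Q : Matrix (Fin m) (Fin m) ℝ} (hQ : Q.PosDef) :
    ∫ Z : Fin m → Fin r → ℝ, exp (-(Q * (of Z * (of Z)ᵀ)).trace) =
      Q.det ^ (-(r : ℝ) / 2) * π ^ ((m : ℝ) * r / 2) := by
  have hdet := hQ.det_pos
  obtain ⟨B, rfl⟩ := hQ.exists_eq_transpose_mul_self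
  rw [det_mul, det_transpose, ← sq] at hdet ⊢
  have hB : B.det ≠ 0 := by
    rintro h
    simp [h] at hdet
  have hL : LinearMap.det (leftMul r B) ≠ 0 := by
    rw [det_leftMul]
    exact pow_ne_zero _ hB
  have hmap := Measure.map_linearMap_addHaar_eq_smul_addHaar
    (volume : Measure (Fin m → Fin r → ℝ)) hL
  have hcont : Continuous (leftMul r B) := LinearMap.continuous_of_finiteDimensional _
  have hint := integral_map (μ := volume) hcont.aemeasurable
    (f := fun Z : Fin m → Fin r → ℝ => exp (-∑ i, ∑ j, Z i j ^ 2))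
    (Continuous.aestronglyMeasurable (by fun_prop))
  rw [hmap, integral_smul_measure, integral_exp_neg_sum_sq, det_leftMul,
    ENNReal.toReal_ofReal (abs_nonneg _), smul_eq_mul] at hint
  simp only [trace_transpose_mul_mul]
  rw [← hint, abs_inv, abs_pow, ← sq_abs, ← rpow_natCast _ 2, ← rpow_mul (abs_nonneg _),
    ← rpow_natCast _ r, ← rpow_neg (abs_nonneg _)]
  congr 2
  push_cast
  ring

end Gaussian

lemma isOpen_setOf_det_pos (m : ℕ) :
    IsOpen {x : Fin m → Fin m → ℝ | 0 < (Matrix.of x).det} :=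
  isOpen_lt continuous_const (Continuous.matrix_det continuous_id)

lemma contDiff_det (m : ℕ) :
    ContDiff ℝ (⊤ : ℕ∞) (fun x : Fin m → Fin m → ℝ => (Matrix.of x).det) := by
  simp only [Matrix.det_apply, Matrix.of_apply]
  fun_prop

lemma det_rpow_eq_integral {m : ℕ} (r : ℕ) {Q : Matrix (Fin m) (Fin m) ℝ} (hQ : Q.PosDef) :
    Q.det ^ (-(r : ℝ) / 2) =
      π ^ (-((m : ℝ) * r) / 2) *
        ∫ Z : Fin m → Fin r → ℝ,
          Real.exp (-(Q * (Matrix.of Z * (Matrix.of Z).transpose)).trace) := by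
  rw [integral_exp_neg_trace_mul r hQ, mul_left_comm, ← rpow_add pi_pos]
  simp [neg_div]

lemma integrable_exp_neg_trace_mul {m : ℕ} (r : ℕ) {Q : Matrix (Fin m) (Fin m) ℝ}
    (hQ : Q.PosDef) :
    Integrable fun Z : Fin m → Fin r → ℝ =>
      exp (-(Q * (Matrix.of Z * (Matrix.of Z).transpose)).trace) := by
  refine .of_integral_ne_zero ?_
  rw [integral_exp_neg_trace_mul r hQ]
  exact (mul_pos (rpow_pos_of_pos hQ.det_pos _) (rpow_pos_of_pos pi_pos _)).ne'

lemma trace_mul_mul_transpose_nonneg {m r : ℕ} {Q : Matrix (Fin m) (Fin m) ℝ} (hQ : Q.PosDef)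
    (Z : Fin m → Fin r → ℝ) :
    0 ≤ (Q * (Matrix.of Z * (Matrix.of Z).transpose)).trace := by
  obtain ⟨B, rfl⟩ := hQ.exists_eq_transpose_mul_self
  rw [trace_transpose_mul_mul]
  positivity

lemma completelyMonotoneOn_det_rpow (m r : ℕ) :
    CompletelyMonotoneOn
      (fun x : Fin m → Fin m → ℝ => (Matrix.of x).det ^ (-(r : ℝ) / 2))
      {x : Fin m → Fin m → ℝ | (Matrix.of x).IsSymm ∧ (Matrix.of x).PosDef} := by
  have hadd : ∀ x ∈ {x : Fin m → Fin m → ℝ | (Matrix.of x).IsSymm ∧ (Matrix.of x).PosDef},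
      ∀ y ∈ {x : Fin m → Fin m → ℝ | (Matrix.of x).IsSymm ∧ (Matrix.of x).PosDef},
      x + y ∈ {x : Fin m → Fin m → ℝ | (Matrix.of x).IsSymm ∧ (Matrix.of x).PosDef} :=
    fun x hx y hy => ⟨hx.1.add hy.1, hx.2.add hy.2⟩
  refine completelyMonotoneOn_of_altDiff_nonneg hadd
    (fun c hc x hx => ⟨hx.1.smul c, hx.2.smul hc⟩) (isOpen_setOf_det_pos m)
    (fun x hx => hx.2.det_pos) ?_ fun l hl => ?_
  · exact (contDiff_det m).contDiffOn.rpow_const_of_ne fun x hx => ne_of_gt hx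
  · refine altDiff_integral_exp_nonneg hadd (μ := (volume : Measure (Fin m → Fin r → ℝ)))
      (p := fun x Z => (Matrix.of x * (Matrix.of Z * (Matrix.of Z).transpose)).trace)
      (φ := fun _ => π ^ (-((m : ℝ) * r) / 2)) (fun x y Z => ?_)
      (fun x hx Z => trace_mul_mul_transpose_nonneg hx.2 Z) l hl
      (fun _ => rpow_nonneg pi_pos.le _)
      (fun x hx => (integrable_exp_neg_trace_mul r hx.2).mul_const _) (fun x hx => ?_)
    · rw [← Matrix.trace_add, ← Matrix.add_mul]
      rfl
    · rw [integral_mul_const, mul_comm]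
      exact det_rpow_eq_integral r hx.2

/-- For `0 ≤ r ≤ m−1`: for every positive definite symmetric `m×m` matrix `Q`,
`(det Q)^{−r/2} = π^{−mr/2} ∫_{ℝ^{m×r}} exp(−tr(Q Z Zᵀ)) dZ`.  Consequently `Q ↦ det(Q)^{−r/2}`
is completely monotone on the positive definite cone, with Riesz measure the pushforward of
`π^{−mr/2} dZ` under `Z ↦ Z Zᵀ`. -/
theorem statement9 (m r : ℕ) (hm : 1 ≤ m) (hr : r < m) :
    (∀ Q : Matrix (Fin m) (Fin m) ℝ, Q.IsSymm → Q.PosDef →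
      Q.det ^ (-(r : ℝ) / 2) =
        π ^ (-((m : ℝ) * r) / 2) *
          ∫ Z : Fin m → Fin r → ℝ,
            Real.exp (-(Q * (Matrix.of Z * (Matrix.of Z).transpose)).trace)) ∧
    CompletelyMonotoneOn
      (fun x : Fin m → Fin m → ℝ => (Matrix.of x).det ^ (-(r : ℝ) / 2))
      {x : Fin m → Fin m → ℝ | (Matrix.of x).IsSymm ∧ (Matrix.of x).PosDef} ∧
    ∀ x : Fin m → Fin m → ℝ, (Matrix.of x).IsSymm → (Matrix.of x).PosDef →
      (Matrix.of x).det ^ (-(r : ℝ) / 2) =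
        ∫ y, Real.exp (-(Matrix.of x * Matrix.of y).trace)
          ∂((ENNReal.ofReal (π ^ (-((m : ℝ) * r) / 2)) • volume).map
            (fun Z : Fin m → Fin r → ℝ => (fun i j => ∑ k, Z i k * Z j k : Fin m → Fin m → ℝ))) := by
  refine ⟨fun Q _ hQ => det_rpow_eq_integral r hQ, completelyMonotoneOn_det_rpow m r,
    fun x _ hx => ?_⟩
  rw [integral_map (Continuous.aemeasurable (by fun_prop))
    (Continuous.aestronglyMeasurable ?_), integral_smul_measure,
    ENNReal.toReal_ofReal (rpow_nonneg pi_pos.le _), smul_eq_mul]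
  · exact det_rpow_eq_integral r hx
  · exact Real.continuous_exp.comp
      ((continuous_const.matrix_mul continuous_id).matrix_trace).neg
end

section
/- Let A₁,…,Aₙ be linearly independent real symmetric m×m matrices such that the spectrahedral cone C = {x ∈ ℝⁿ : x₁A₁ + ⋯ + xₙAₙ is positive definite} is nonempty, and set p(x) = det(x₁A₁ + ⋯ + xₙAₙ). If α ∈ {0, 1/2, 1, 3/2, …, (m−1)/2} or α > (m−1)/2, then the function p^{−α} is completely monotone on C. -/
open MeasureTheory Real Set

section AlternatingDifferences

variable {E F : Type*} [AddCommGroup E] [AddCommGroup F]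

/-- All `k`-fold alternating differences of `f` along vectors of `C` are nonnegative on `C`. -/
def AltDiffNonneg (C : Set E) : ℕ → (E → ℝ) → Prop
  | 0, f => ∀ x ∈ C, 0 ≤ f x
  | k + 1, f => ∀ v ∈ C, AltDiffNonneg C k (fun x => f x - f (x + v))

/-- Alternating differences of every order are nonnegative: the discrete form of complete
monotonicity, which involves no smoothness. -/
def DiscretelyMonotone (C : Set E) (f : E → ℝ) : Prop := ∀ k, AltDiffNonneg C k f

variable {C : Set E}

theorem AltDiffNonneg.congr (hC : ∀ x ∈ C, ∀ y ∈ C, x + y ∈ C) {k : ℕ} {f g : E → ℝ}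
    (hf : AltDiffNonneg C k f) (hfg : ∀ x ∈ C, f x = g x) : AltDiffNonneg C k g := by
  induction k generalizing f g with
  | zero => exact fun x hx => hfg x hx ▸ hf x hx
  | succ k ih =>
    refine fun v hv => ih (hf v hv) fun x hx => ?_
    rw [hfg x hx, hfg _ (hC x hx v hv)]

theorem DiscretelyMonotone.congr (hC : ∀ x ∈ C, ∀ y ∈ C, x + y ∈ C) {f g : E → ℝ}
    (hf : DiscretelyMonotone C f) (hfg : ∀ x ∈ C, f x = g x) : DiscretelyMonotone C g :=
  fun k => (hf k).congr hC hfg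

theorem AltDiffNonneg.add {k : ℕ} {f g : E → ℝ} (hf : AltDiffNonneg C k f)
    (hg : AltDiffNonneg C k g) : AltDiffNonneg C k (fun x => f x + g x) := by
  induction k generalizing f g with
  | zero => exact fun x hx => add_nonneg (hf x hx) (hg x hx)
  | succ k ih =>
    intro v hv
    convert ih (hf v hv) (hg v hv) using 2
    ring

theorem AltDiffNonneg.const_mul {k : ℕ} {f : E → ℝ} (hf : AltDiffNonneg C k f) {c : ℝ}
    (hc : 0 ≤ c) : AltDiffNonneg C k (fun x => c * f x) := by
  induction k generalizing f with
  | zero => exact fun x hx => mul_nonneg hc (hf x hx)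
  | succ k ih =>
    intro v hv
    convert ih (hf v hv) using 2
    ring

theorem AltDiffNonneg.translate (hC : ∀ x ∈ C, ∀ y ∈ C, x + y ∈ C) {k : ℕ} {f : E → ℝ}
    (hf : AltDiffNonneg C k f) {w : E} (hw : w ∈ C) : AltDiffNonneg C k (fun x => f (x + w)) := by
  induction k generalizing f with
  | zero => exact fun x hx => hf _ (hC x hx w hw)
  | succ k ih =>
    intro v hv
    convert ih (hf v hv) using 2
    rw [add_right_comm]

theorem DiscretelyMonotone.sub_translate {f : E → ℝ} (hf : DiscretelyMonotone C f) {v : E}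
    (hv : v ∈ C) : DiscretelyMonotone C (fun x => f x - f (x + v)) :=
  fun k => hf (k + 1) v hv

theorem DiscretelyMonotone.const_mul {f : E → ℝ} (hf : DiscretelyMonotone C f) {c : ℝ}
    (hc : 0 ≤ c) : DiscretelyMonotone C (fun x => c * f x) :=
  fun k => (hf k).const_mul hc

theorem DiscretelyMonotone.mul (hC : ∀ x ∈ C, ∀ y ∈ C, x + y ∈ C) {f g : E → ℝ}
    (hf : DiscretelyMonotone C f) (hg : DiscretelyMonotone C g) :
    DiscretelyMonotone C (fun x => f x * g x) := by
  intro k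
  induction k generalizing f g with
  | zero => exact fun x hx => mul_nonneg (hf 0 x hx) (hg 0 x hx)
  | succ k ih =>
    intro v hv
    convert (ih (hf.sub_translate hv) hg).add
      (ih (fun j => (hf j).translate hC hv) (hg.sub_translate hv)) using 2
    ring

theorem AltDiffNonneg.comp_add_hom {k : ℕ} {f : F → ℝ} {C' : Set F} (L : E →+ F)
    (hL : ∀ x ∈ C, L x ∈ C') (hf : AltDiffNonneg C' k f) :
    AltDiffNonneg C k (fun x => f (L x)) := by
  induction k generalizing f with
  | zero => exact fun x hx => hf _ (hL x hx)
  | succ k ih =>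
    intro v hv
    simpa only [map_add] using ih (hf _ (hL v hv))

theorem DiscretelyMonotone.comp_add_hom {f : F → ℝ} {C' : Set F} (hf : DiscretelyMonotone C' f)
    (L : E →+ F) (hL : ∀ x ∈ C, L x ∈ C') : DiscretelyMonotone C (fun x => f (L x)) :=
  fun k => (hf k).comp_add_hom L hL

theorem discretelyMonotone_exp_neg (L : E →+ ℝ) (hL : ∀ x ∈ C, 0 ≤ L x) {c : ℝ} (hc : 0 ≤ c) :
    DiscretelyMonotone C (fun x => c * exp (-L x)) := by
  intro k
  induction k generalizing c with
  | zero => exact fun x _ => by positivity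
  | succ k ih =>
    intro v hv
    have h : 0 ≤ c * (1 - exp (-L v)) :=
      mul_nonneg hc (sub_nonneg.2 (exp_le_one_iff.2 (neg_nonpos.2 (hL v hv))))
    convert ih h using 2
    simp only [map_add, neg_add, exp_add]
    ring

theorem discretelyMonotone_one : DiscretelyMonotone C (fun _ => (1 : ℝ)) := by
  simpa using discretelyMonotone_exp_neg (C := C) (0 : E →+ ℝ) (by simp) zero_le_one

theorem DiscretelyMonotone.integral {Ω : Type*} [MeasurableSpace Ω] {μ : Measure Ω}
    (hC : ∀ x ∈ C, ∀ y ∈ C, x + y ∈ C) {f : Ω → E → ℝ} (hf : ∀ ω, DiscretelyMonotone C (f ω))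
    (hint : ∀ x ∈ C, Integrable (fun ω => f ω x) μ) :
    DiscretelyMonotone C (fun x => ∫ ω, f ω x ∂μ) := by
  intro k
  induction k generalizing f with
  | zero => exact fun x hx => integral_nonneg fun ω => hf ω 0 x hx
  | succ k ih =>
    intro v hv
    refine (ih (fun ω => (hf ω).sub_translate hv)
      fun x hx => (hint x hx).sub (hint _ (hC x hx v hv))).congr hC fun x hx => ?_
    exact integral_sub (hint x hx) (hint _ (hC x hx v hv))

theorem AltDiffNonneg.of_tendsto (hC : ∀ x ∈ C, ∀ y ∈ C, x + y ∈ C) {ι : Type*} {l : Filter ι}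
    [l.NeBot] {k : ℕ} {f : ι → E → ℝ} {g : E → ℝ} (hf : ∀ᶠ i in l, AltDiffNonneg C k (f i))
    (hlim : ∀ x ∈ C, Filter.Tendsto (fun i => f i x) l (nhds (g x))) : AltDiffNonneg C k g := by
  induction k generalizing f g with
  | zero => exact fun x hx => ge_of_tendsto (hlim x hx) (hf.mono fun i hi => hi x hx)
  | succ k ih =>
    exact fun v hv => ih (hf.mono fun i hi => hi v hv)
      fun x hx => (hlim x hx).sub (hlim _ (hC x hx v hv))

end AlternatingDifferences

section Derivatives

variable {E : Type*} [NormedAddCommGroup E] [NormedSpace ℝ E] {C : Set E}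

theorem DiscretelyMonotone.neg_fderiv (hC : ∀ x ∈ C, ∀ y ∈ C, x + y ∈ C)
    (hsmul : ∀ c : ℝ, 0 < c → ∀ x ∈ C, c • x ∈ C) {f : E → ℝ} (hf : DiscretelyMonotone C f)
    (hd : ∀ x ∈ C, DifferentiableAt ℝ f x) {v : E} (hv : v ∈ C) :
    DiscretelyMonotone C (fun x => -fderiv ℝ f x v) := by
  intro k
  refine AltDiffNonneg.of_tendsto hC (l := nhdsWithin (0 : ℝ) (Ioi 0))
    (f := fun t x => t⁻¹ * (f x - f (x + t • v))) ?_ fun x hx => ?_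
  · filter_upwards [self_mem_nhdsWithin] with t ht
    exact (hf (k + 1) _ (hsmul t ht v hv)).const_mul (inv_nonneg.2 (le_of_lt ht))
  · have h := ((hd x hx).hasFDerivAt.hasLineDerivAt v).tendsto_slope_zero_right.neg
    refine h.congr fun t => ?_
    rw [smul_eq_mul]
    ring

theorem contDiffOn_iterDirDeriv (hopen : IsOpen C) {f : E → ℝ}
    (hf : ContDiffOn ℝ (⊤ : ℕ∞) f C) (k : ℕ) (v : ℕ → E) :
    ContDiffOn ℝ (⊤ : ℕ∞) (iterDirDeriv k v f) C := by
  induction k generalizing v with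
  | zero => exact hf
  | succ k ih => exact ((ih _).fderiv_of_isOpen hopen (by simp)).clm_apply contDiffOn_const

theorem DiscretelyMonotone.completelyMonotoneOn (hopen : IsOpen C)
    (hC : ∀ x ∈ C, ∀ y ∈ C, x + y ∈ C) (hsmul : ∀ c : ℝ, 0 < c → ∀ x ∈ C, c • x ∈ C)
    {f : E → ℝ} (hf : DiscretelyMonotone C f) (hd : ContDiffOn ℝ (⊤ : ℕ∞) f C) :
    CompletelyMonotoneOn f C := by
  have key (k : ℕ) (v : ℕ → E) (hv : ∀ i, v i ∈ C) :
      DiscretelyMonotone C (fun x => (-1 : ℝ) ^ k * iterDirDeriv k v f x) := by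
    induction k generalizing v with
    | zero => simpa [iterDirDeriv] using hf
    | succ k ih =>
      have hdiff (x : E) (hx : x ∈ C) :
          DifferentiableAt ℝ (iterDirDeriv k (fun i => v (i + 1)) f) x :=
        ((contDiffOn_iterDirDeriv hopen hd k _).differentiableOn (by simp)).differentiableAt
          (hopen.mem_nhds hx)
      refine ((ih _ fun i => hv (i + 1)).neg_fderiv hC hsmul
        (fun x hx => (hdiff x hx).const_mul _) (hv 0)).congr hC fun x hx => ?_
      rw [fderiv_const_mul (hdiff x hx)]
      simp [iterDirDeriv, pow_succ]
  exact ⟨hd, fun k v hv => key k v hv 0⟩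

end Derivatives

section GaussianIntegral

theorem integral_abs_rpow_mul_exp_neg_sq_pos {β : ℝ} (hβ : -1 < β) :
    0 < ∫ t : ℝ, |t| ^ β * exp (-(t * t)) := by
  have h := integral_comp_abs (f := fun t => t ^ β * exp (-1 * t ^ (2 : ℝ)))
  rw [integral_rpow_mul_exp_neg_mul_rpow two_pos hβ one_pos] at h
  have hG : 0 < Real.Gamma ((β + 1) / 2) := Gamma_pos_of_pos (by linarith)
  have heq (t : ℝ) : |t| ^ β * exp (-(t * t)) = |t| ^ β * exp (-1 * |t| ^ (2 : ℝ)) := by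
    rw [rpow_two, sq_abs, neg_one_mul, sq]
  simp_rw [heq, h]
  positivity

open Matrix

variable {ι : Type*} [Fintype ι] [DecidableEq ι]

/-- A standard Gaussian integral with an absolute-power weight in one coordinate. -/
noncomputable def weightedGaussianConst (i₀ : ι) (β : ℝ) : ℝ :=
  ∫ z : ι → ℝ, exp (-(z ⬝ᵥ z)) * |z i₀| ^ β

theorem weightedGaussianConst_pos (i₀ : ι) {β : ℝ} (hβ : -1 < β) :
    0 < weightedGaussianConst i₀ β := by
  have h (z : ι → ℝ) : exp (-(z ⬝ᵥ z)) * |z i₀| ^ β =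
      ∏ i, |z i| ^ (if i = i₀ then β else 0) * exp (-(z i * z i)) := by
    rw [Finset.prod_mul_distrib, ← exp_sum, Finset.sum_neg_distrib, mul_comm]
    congr 1
    rw [Finset.prod_eq_single i₀ (fun i _ hi => by simp [hi]) (by simp)]
    simp
  simp_rw [weightedGaussianConst, h]
  rw [integral_fintype_prod_volume_eq_prod
    (f := fun i t => |t| ^ (if i = i₀ then β else 0) * exp (-(t * t)))]
  refine Finset.prod_pos fun i _ => integral_abs_rpow_mul_exp_neg_sq_pos ?_
  split_ifs <;> linarith

theorem integral_exp_neg_mulVec_mul_abs_rpow {i₀ : ι} {B : Matrix ι ι ℝ} (hB : B.det ≠ 0) {r : ℝ}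
    (hr : 0 < r) (hBr : ∀ y, (B *ᵥ y) i₀ = r * y i₀) (β : ℝ) :
    ∫ y : ι → ℝ, exp (-((B *ᵥ y) ⬝ᵥ (B *ᵥ y))) * |y i₀| ^ β =
      |B.det|⁻¹ * r ^ (-β) * weightedGaussianConst i₀ β := by
  have h (y : ι → ℝ) : exp (-((B *ᵥ y) ⬝ᵥ (B *ᵥ y))) * |y i₀| ^ β =
      r ^ (-β) * (exp (-(toLin' B y ⬝ᵥ toLin' B y)) * |toLin' B y i₀| ^ β) := by
    rw [toLin'_apply, hBr, abs_mul, abs_of_pos hr, mul_rpow hr.le (abs_nonneg _), rpow_neg hr.le]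
    field_simp
  have hm : Measurable (fun z : ι → ℝ => exp (-(z ⬝ᵥ z)) * |z i₀| ^ β) := by
    unfold dotProduct
    fun_prop
  have hL : Measurable (toLin' B) := (toLin' B).continuous_of_finiteDimensional.measurable
  simp_rw [h]
  rw [integral_const_mul, ← integral_map hL.aemeasurable
    (f := fun z : ι → ℝ => exp (-(z ⬝ᵥ z)) * |z i₀| ^ β) hm.aestronglyMeasurable,
    Real.map_matrix_volume_pi_eq_smul_volume_pi hB, integral_smul_measure,
    ENNReal.toReal_ofReal (abs_nonneg _), abs_inv, weightedGaussianConst, smul_eq_mul]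
  ring

end GaussianIntegral

section Determinant

open Matrix

open scoped MatrixOrder Matrix.Norms.L2Operator in
theorem Matrix.PosDef.exists_transpose_mul_self {ι : Type*} [Fintype ι] [DecidableEq ι]
    {X : Matrix ι ι ℝ} (hX : X.PosDef) : ∃ R : Matrix ι ι ℝ, X = Rᵀ * R := by
  obtain ⟨R, hR⟩ := CStarAlgebra.nonneg_iff_eq_star_mul_self.mp hX.posSemidef.nonneg
  exact ⟨R, by simpa [star_eq_conjTranspose] using hR⟩

theorem Matrix.PosDef.toBlocks₂₂ {κ : Type*} {X : Matrix (Unit ⊕ κ) (Unit ⊕ κ) ℝ} (hX : X.PosDef) :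
    X.toBlocks₂₂.PosDef :=
  hX.submatrix Sum.inr_injective

variable {κ : Type*} [Fintype κ] [DecidableEq κ]

/-- A positive definite matrix factors as `Bᵀ B` with the first row of `B` supported on the
first coordinate. -/
theorem Matrix.PosDef.exists_factor {X : Matrix (Unit ⊕ κ) (Unit ⊕ κ) ℝ} (hX : X.PosDef) :
    ∃ B : Matrix (Unit ⊕ κ) (Unit ⊕ κ) ℝ, X = Bᵀ * B ∧
      ∀ y, (B *ᵥ y) (Sum.inl ()) = √(X.det / X.toBlocks₂₂.det) * y (Sum.inl ()) := by
  have hD := hX.toBlocks₂₂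
  have hDdet := hD.det_pos
  obtain ⟨R, hR⟩ := hD.exists_transpose_mul_self
  let _ : Invertible X.toBlocks₂₂ := hD.isUnit.invertible
  have hsymm : Xᵀ = X := by simpa using hX.isHermitian.eq
  have h21 : X.toBlocks₁₂ = X.toBlocks₂₁ᵀ := by
    ext i j
    exact congrFun₂ hsymm (Sum.inl i) (Sum.inr j) |>.symm
  have hDsymm : (X.toBlocks₂₂)ᵀ = X.toBlocks₂₂ := by simpa using hD.isHermitian.eq
  set S := X.toBlocks₁₁ - X.toBlocks₁₂ * ⅟X.toBlocks₂₂ * X.toBlocks₂₁ with hS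
  have hdet : X.det = X.toBlocks₂₂.det * S.det := by
    conv_lhs => rw [← fromBlocks_toBlocks X]
    exact det_fromBlocks₂₂ _ _ _ _
  have hs : X.det / X.toBlocks₂₂.det = S () () := by
    rw [hdet, mul_div_cancel_left₀ _ hDdet.ne', det_unique]
  have hs0 : 0 ≤ S () () := hs ▸ (div_pos hX.det_pos hDdet).le
  set Q : Matrix Unit Unit ℝ := of fun _ _ => √(S () ()) with hQ
  have hQQ : Qᵀ * Q = S := by
    ext i j
    simp [mul_apply, hQ, mul_self_sqrt hs0]
  have hinv : (⅟X.toBlocks₂₂)ᵀ = ⅟X.toBlocks₂₂ := by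
    rw [invOf_eq_nonsing_inv, transpose_nonsing_inv, hDsymm]
  refine ⟨fromBlocks Q 0 0 R * fromBlocks 1 0 (⅟X.toBlocks₂₂ * X.toBlocks₂₁) 1, ?_, fun y => ?_⟩
  · conv_lhs => rw [← fromBlocks_toBlocks X, fromBlocks_eq_of_invertible₂₂, ← hS]
    rw [transpose_mul, Matrix.mul_assoc, Matrix.mul_assoc _ (fromBlocks Q 0 0 R)ᵀ, ← Matrix.mul_assoc (fromBlocks Q 0 0 R)ᵀ,
      fromBlocks_transpose, fromBlocks_transpose, fromBlocks_multiply (Qᵀ), hQQ, ← hR,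
      transpose_mul, hinv, ← h21]
    simp
  · rw [hs, ← mulVec_mulVec]
    simp [mulVec_eq_sum, hQ]

theorem Matrix.PosDef.integral_exp_neg_mul_abs_rpow {X : Matrix (Unit ⊕ κ) (Unit ⊕ κ) ℝ}
    (hX : X.PosDef) (β : ℝ) :
    ∫ y : Unit ⊕ κ → ℝ, exp (-(y ⬝ᵥ X *ᵥ y)) * |y (Sum.inl ())| ^ β =
      weightedGaussianConst (Sum.inl () : Unit ⊕ κ) β *
        (X.det ^ (-(β + 1) / 2) * X.toBlocks₂₂.det ^ (β / 2)) := by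
  obtain ⟨B, hXB, hB⟩ := hX.exists_factor
  have hp := hX.det_pos
  have hq := hX.toBlocks₂₂.det_pos
  have hdet : X.det = B.det * B.det := by
    conv_lhs => rw [hXB, det_mul, det_transpose]
  have habs : |B.det| = X.det ^ (1 / 2 : ℝ) := by
    rw [← sqrt_eq_rpow, hdet, sqrt_mul_self_eq_abs]
  have hB0 : B.det ≠ 0 := fun h => by simp [h, hp.ne'] at hdet
  have hquad (y : Unit ⊕ κ → ℝ) : y ⬝ᵥ X *ᵥ y = (B *ᵥ y) ⬝ᵥ (B *ᵥ y) := by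
    rw [hXB, ← mulVec_mulVec, dotProduct_mulVec, vecMul_transpose]
  simp_rw [hquad]
  rw [integral_exp_neg_mulVec_mul_abs_rpow hB0 (sqrt_pos.2 (div_pos hp hq)) hB, habs,
    sqrt_eq_rpow, ← rpow_mul (div_pos hp hq).le, div_rpow hp.le hq.le, ← rpow_neg hp.le,
    mul_comm _ (weightedGaussianConst _ _), div_eq_mul_inv (_ ^ _), ← rpow_neg hq.le, ← mul_assoc (_ ^ _),
    ← rpow_add hp]
  congr 3 <;> ring

end Determinant

section DeterminantPowers

open Matrix

theorem posDef_add_mem {ι : Type*} :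
    ∀ X ∈ {X : Matrix ι ι ℝ | X.PosDef}, ∀ Y ∈ {X : Matrix ι ι ℝ | X.PosDef},
      X + Y ∈ {X : Matrix ι ι ℝ | X.PosDef} :=
  fun _ hX _ hY => PosDef.add hX hY

theorem discretelyMonotone_det_rpow_mul {κ : Type*} [Fintype κ] [DecidableEq κ] {β : ℝ}
    (hβ : -1 < β) :
    DiscretelyMonotone {X : Matrix (Unit ⊕ κ) (Unit ⊕ κ) ℝ | X.PosDef}
      (fun X => X.det ^ (-(β + 1) / 2) * X.toBlocks₂₂.det ^ (β / 2)) := by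
  have hK := weightedGaussianConst_pos (Sum.inl () : Unit ⊕ κ) hβ
  refine ((DiscretelyMonotone.integral (μ := volume)
    (f := fun (y : Unit ⊕ κ → ℝ) X => |y (Sum.inl ())| ^ β * exp (-(y ⬝ᵥ X *ᵥ y)))
    posDef_add_mem (fun y => ?_) fun X (hX : X.PosDef) => ?_).const_mul
      (inv_nonneg.2 hK.le)).congr posDef_add_mem fun X (hX : X.PosDef) => ?_
  · refine discretelyMonotone_exp_neg
      (AddMonoidHom.mk' (fun X : Matrix (Unit ⊕ κ) (Unit ⊕ κ) ℝ => y ⬝ᵥ X *ᵥ y) fun X Y => ?_)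
      (fun X (hX : X.PosDef) => ?_) (by positivity)
    · rw [add_mulVec, dotProduct_add]
    · simpa using hX.posSemidef.dotProduct_mulVec_nonneg y
  · refine Integrable.of_integral_ne_zero ?_
    simp_rw [mul_comm (|_| ^ β)]
    rw [hX.integral_exp_neg_mul_abs_rpow]
    have := hX.det_pos
    have := hX.toBlocks₂₂.det_pos
    positivity
  · simp_rw [mul_comm (|_| ^ β)]
    rw [hX.integral_exp_neg_mul_abs_rpow, inv_mul_cancel_left₀ hK.ne']

theorem DiscretelyMonotone.det_rpow_of_equiv {ι κ : Type*} [Fintype ι] [DecidableEq ι] [Fintype κ]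
    [DecidableEq κ] (e : κ ≃ ι) {α : ℝ}
    (h : DiscretelyMonotone {X : Matrix κ κ ℝ | X.PosDef} (fun X => X.det ^ α)) :
    DiscretelyMonotone {X : Matrix ι ι ℝ | X.PosDef} (fun X => X.det ^ α) := by
  refine (h.comp_add_hom (C := {X : Matrix ι ι ℝ | X.PosDef})
    (AddMonoidHom.mk' (fun X : Matrix ι ι ℝ => X.submatrix e e) fun X Y => by ext; rfl)
    fun X (hX : X.PosDef) => hX.submatrix e.injective).congr posDef_add_mem fun X _ => ?_
  exact congrArg (· ^ α) (det_submatrix_equiv_self e X)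

theorem discretelyMonotone_det_rpow_neg_half (m : ℕ) :
    DiscretelyMonotone {X : Matrix (Fin m) (Fin m) ℝ | X.PosDef}
      (fun X => X.det ^ (-(1 / 2) : ℝ)) := by
  cases m with
  | zero => simpa using discretelyMonotone_one
  | succ m =>
    refine DiscretelyMonotone.det_rpow_of_equiv
      (Fintype.equivOfCardEq (α := Unit ⊕ Fin m) (by simp [add_comm])) ?_
    simpa [neg_div] using discretelyMonotone_det_rpow_mul (κ := Fin m) (β := 0) (by norm_num)

theorem discretelyMonotone_det_rpow_neg_nat_div_two (m k : ℕ) :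
    DiscretelyMonotone {X : Matrix (Fin m) (Fin m) ℝ | X.PosDef}
      (fun X => X.det ^ (-(k / 2) : ℝ)) := by
  induction k with
  | zero => simpa using discretelyMonotone_one
  | succ k ih =>
    refine (ih.mul posDef_add_mem (discretelyMonotone_det_rpow_neg_half m)).congr posDef_add_mem
      fun X (hX : X.PosDef) => ?_
    rw [← rpow_add hX.det_pos]
    push_cast
    ring_nf

theorem discretelyMonotone_det_rpow_neg {m : ℕ} {α : ℝ} (hα : ((m : ℝ) - 1) / 2 < α) :
    DiscretelyMonotone {X : Matrix (Fin m) (Fin m) ℝ | X.PosDef} (fun X => X.det ^ (-α)) := by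
  induction m generalizing α with
  | zero => simpa using discretelyMonotone_one
  | succ m ih =>
    push_cast at hα
    have hm : (0 : ℝ) ≤ m := m.cast_nonneg
    refine DiscretelyMonotone.det_rpow_of_equiv
      (Fintype.equivOfCardEq (α := Unit ⊕ Fin m) (by simp [add_comm])) ?_
    have h₁ := discretelyMonotone_det_rpow_mul (κ := Fin m) (β := 2 * α - 1) (by linarith)
    have h₂ : DiscretelyMonotone {X : Matrix (Unit ⊕ Fin m) (Unit ⊕ Fin m) ℝ | X.PosDef}
        (fun X => X.toBlocks₂₂.det ^ (-(α - 1 / 2))) :=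
      (ih (α := α - 1 / 2) (by linarith)).comp_add_hom
        (AddMonoidHom.mk' toBlocks₂₂ fun X Y => by ext; rfl)
        fun X (hX : X.PosDef) => hX.toBlocks₂₂
    refine (h₁.mul posDef_add_mem h₂).congr posDef_add_mem fun X (hX : X.PosDef) => ?_
    rw [mul_assoc, ← rpow_add hX.toBlocks₂₂.det_pos]
    ring_nf
    simp

end DeterminantPowers

section Pencil

open Matrix

variable {n m : ℕ} (A : Fin n → Matrix (Fin m) (Fin m) ℝ)

theorem isOpen_setOf_pencil_posDef (hsym : ∀ i, (A i).IsSymm) :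
    IsOpen {x : Fin n → ℝ | (∑ i, x i • A i).PosDef} := by
  have hcont : Continuous fun q : (Fin n → ℝ) × (Fin m → ℝ) =>
      q.2 ⬝ᵥ (∑ i, q.1 i • A i) *ᵥ q.2 := by
    fun_prop
  have hherm (x : Fin n → ℝ) : (∑ i, x i • A i).IsHermitian := by
    rw [IsHermitian, conjTranspose_eq_transpose_of_trivial, transpose_sum]
    simp_rw [transpose_smul, (hsym _).eq]
  rw [isOpen_iff_mem_nhds]
  intro x (hx : (∑ i, x i • A i).PosDef)
  have hsphere : ∀ᶠ z in nhds x, ∀ y ∈ Metric.sphere (0 : Fin m → ℝ) 1,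
      0 < y ⬝ᵥ (∑ i, z i • A i) *ᵥ y := by
    refine (isCompact_sphere _ _).eventually_forall_of_forall_eventually fun y hy => ?_
    refine (hcont.tendsto (x, y)).eventually (lt_mem_nhds ?_)
    simpa using hx.dotProduct_mulVec_pos (ne_zero_of_mem_unit_sphere (⟨y, hy⟩ : Metric.sphere _ _))
  filter_upwards [hsphere] with z hz
  refine PosDef.of_dotProduct_mulVec_pos (hherm z) fun y hy => ?_
  have hpos : 0 < ‖y‖⁻¹ := inv_pos.2 (norm_pos_iff.2 hy)
  have h := hz (‖y‖⁻¹ • y) (by simp [norm_smul, hy])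
  rw [mulVec_smul, smul_dotProduct, dotProduct_smul, smul_eq_mul, smul_eq_mul,
    mul_pos_iff_of_pos_left hpos, mul_pos_iff_of_pos_left hpos] at h
  simpa using h

theorem contDiff_det_pencil : ContDiff ℝ (⊤ : ℕ∞) fun x : Fin n → ℝ => (∑ i, x i • A i).det := by
  simp_rw [det_apply, Matrix.sum_apply, Matrix.smul_apply]
  fun_prop

end Pencil

/-- Let `A₁,…,Aₙ` be linearly independent real symmetric `m×m` matrices with
nonempty spectrahedral cone `C = {x : ∑ xᵢAᵢ ≻ 0}`, and `p(x) = det(∑ xᵢAᵢ)`.  If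
`α ∈ {0,1/2,…,(m−1)/2}` or `α > (m−1)/2`, then `p^{−α}` is completely monotone on `C`. -/
theorem statement10 (n m : ℕ) (A : Fin n → Matrix (Fin m) (Fin m) ℝ)
    (hsym : ∀ i, (A i).IsSymm) (hli : LinearIndependent ℝ A)
    (C : Set (Fin n → ℝ)) (hC : C = {x | (∑ i, x i • A i).PosDef}) (hCne : C.Nonempty)
    (α : ℝ) (hα : (∃ k : ℕ, k ≤ m - 1 ∧ α = k / 2) ∨ ((m : ℝ) - 1) / 2 < α) :
    CompletelyMonotoneOn (fun x : Fin n → ℝ => (∑ i, x i • A i).det ^ (-α)) C := by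
  subst hC
  have hdm : DiscretelyMonotone {X : Matrix (Fin m) (Fin m) ℝ | X.PosDef}
      (fun X => X.det ^ (-α)) := by
    rcases hα with ⟨k, -, rfl⟩ | hα
    · exact discretelyMonotone_det_rpow_neg_nat_div_two m k
    · exact discretelyMonotone_det_rpow_neg hα
  let L : (Fin n → ℝ) →+ Matrix (Fin m) (Fin m) ℝ :=
    AddMonoidHom.mk' (fun x => ∑ i, x i • A i) fun x y => by
      simp [add_smul, Finset.sum_add_distrib]
  refine (hdm.comp_add_hom L fun x hx => hx).completelyMonotoneOn
    (isOpen_setOf_pencil_posDef A hsym) (fun x hx y hy => ?_) (fun c hc x hx => ?_)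
    ((contDiff_det_pencil A).contDiffOn.rpow_const_of_ne fun x hx => (Matrix.PosDef.det_pos hx).ne')
  · have h : (L x + L y).PosDef := Matrix.PosDef.add hx hy
    rwa [← map_add] at h
  · have h : (c • ∑ i, x i • A i).PosDef := Matrix.PosDef.smul hx hc
    simpa [Finset.smul_sum, smul_smul] using h
end
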